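/- For x > 0, the derivative of the Airy function satisfies |Ai'(x)| ≤ (x^{1/4} e^{−(2/3)x^{3/2}} / (2√π)) · (1 + 7/(48 x^{3/2})), and consequently sup_{s ≥ 1} e^{s/2} s² |Ai'(s/2)| < ∞. -/

import Mathlib

open Real Filter

/-- The building block `x ^ p * exp (-(2/3) x ^ (3/2))` of the WKB expansions of Airy functions. -/
noncomputable def airyWKB (p x : ℝ) : ℝ := x ^ p * Real.exp (-(2 / 3) * x ^ ((3 : ℝ) / 2))

lemma airyWKB_pos (p : ℝ) {x : ℝ} (hx : 0 < x) : 0 < airyWKB p x := by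
  unfold airyWKB; positivity

lemma airyWKB_eq_rpow_mul (p q : ℝ) {x : ℝ} (hx : 0 < x) :
    airyWKB p x = x ^ (p - q) * airyWKB q x := by
  unfold airyWKB
  rw [← mul_assoc, ← Real.rpow_add hx, sub_add_cancel]

lemma mul_airyWKB {p q x : ℝ} (hx : 0 < x) (h : p + 1 = q) : x * airyWKB p x = airyWKB q x := by
  rw [airyWKB_eq_rpow_mul q p hx, ← h, add_sub_cancel_left, Real.rpow_one]

lemma hasDerivAt_airyWKB {p q r x : ℝ} (hx : 0 < x) (hq : p - 1 = q) (hr : p + 1 / 2 = r) :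
    HasDerivAt (airyWKB p) (p * airyWKB q x - airyWKB r x) x := by
  subst hq hr
  have h1 : HasDerivAt (fun t : ℝ => t ^ p) (p * x ^ (p - 1)) x :=
    Real.hasDerivAt_rpow_const (Or.inl hx.ne')
  have h2 : HasDerivAt (fun t : ℝ => t ^ ((3 : ℝ) / 2)) (3 / 2 * x ^ ((3 : ℝ) / 2 - 1)) x :=
    Real.hasDerivAt_rpow_const (Or.inl hx.ne')
  refine (h1.mul (h2.const_mul (-(2 / 3))).exp).congr_deriv ?_
  unfold airyWKB
  rw [Real.rpow_add hx, show (3 : ℝ) / 2 - 1 = 1 / 2 by norm_num]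
  ring

lemma tendsto_airyWKB_atTop (p : ℝ) : Tendsto (airyWKB p) atTop (nhds 0) := by
  have h := (tendsto_rpow_mul_exp_neg_mul_atTop_nhds_zero (p / (3 / 2)) (2 / 3) (by norm_num)).comp
    (tendsto_rpow_atTop (show (0 : ℝ) < 3 / 2 by norm_num))
  refine h.congr' ?_
  filter_upwards [eventually_gt_atTop 0] with x hx
  simp only [Function.comp, airyWKB]
  rw [← Real.rpow_mul hx.le, mul_div_cancel₀ p (by norm_num)]

/-- The two-term WKB approximation of `-Ai'`, up to the factor `1 / (2 * √π)`. -/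
noncomputable def airyDerivApprox (x : ℝ) : ℝ := airyWKB (1 / 4) x + 7 / 48 * airyWKB (-5 / 4) x

/-- The approximation of `Ai` given by minus the derivative of `airyDerivApprox` divided by `x`. -/
noncomputable def airyApprox (x : ℝ) : ℝ :=
  airyWKB (-1 / 4) x - 5 / 48 * airyWKB (-7 / 4) x + 35 / 192 * airyWKB (-13 / 4) x

lemma airyDerivApprox_pos {x : ℝ} (hx : 0 < x) : 0 < airyDerivApprox x := by
  have := airyWKB_pos (1 / 4) hx
  have := airyWKB_pos (-5 / 4) hx
  unfold airyDerivApprox; positivity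

lemma hasDerivAt_airyDerivApprox {x : ℝ} (hx : 0 < x) :
    HasDerivAt airyDerivApprox (-(x * airyApprox x)) x := by
  have h1 := hasDerivAt_airyWKB (p := 1 / 4) (q := -3 / 4) (r := 3 / 4) hx
    (by norm_num) (by norm_num)
  have h2 := hasDerivAt_airyWKB (p := -5 / 4) (q := -9 / 4) (r := -3 / 4) hx
    (by norm_num) (by norm_num)
  refine (h1.add (h2.const_mul (7 / 48))).congr_deriv ?_
  unfold airyApprox
  have e1 := mul_airyWKB (p := -1 / 4) (q := 3 / 4) hx (by norm_num)
  have e2 := mul_airyWKB (p := -7 / 4) (q := -3 / 4) hx (by norm_num)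
  have e3 := mul_airyWKB (p := -13 / 4) (q := -9 / 4) hx (by norm_num)
  linear_combination e1 - 5 / 48 * e2 + 35 / 192 * e3

lemma hasDerivAt_airyApprox {x : ℝ} (hx : 0 < x) :
    HasDerivAt airyApprox (-airyDerivApprox x - 455 / 768 * airyWKB (-17 / 4) x) x := by
  have h1 := hasDerivAt_airyWKB (p := -1 / 4) (q := -5 / 4) (r := 1 / 4) hx
    (by norm_num) (by norm_num)
  have h2 := hasDerivAt_airyWKB (p := -7 / 4) (q := -11 / 4) (r := -5 / 4) hx
    (by norm_num) (by norm_num)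
  have h3 := hasDerivAt_airyWKB (p := -13 / 4) (q := -17 / 4) (r := -11 / 4) hx
    (by norm_num) (by norm_num)
  refine ((h1.sub (h2.const_mul (5 / 48))).add (h3.const_mul (35 / 192))).congr_deriv ?_
  unfold airyDerivApprox
  ring

lemma tendsto_airyDerivApprox_atTop : Tendsto airyDerivApprox atTop (nhds 0) := by
  have h := (tendsto_airyWKB_atTop (1 / 4)).add
    ((tendsto_airyWKB_atTop (-5 / 4)).const_mul (7 / 48))
  rwa [mul_zero, add_zero] at h

lemma tendsto_airyApprox_atTop : Tendsto airyApprox atTop (nhds 0) := by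
  have h := ((tendsto_airyWKB_atTop (-1 / 4)).sub
    ((tendsto_airyWKB_atTop (-7 / 4)).const_mul (5 / 48))).add
    ((tendsto_airyWKB_atTop (-13 / 4)).const_mul (35 / 192))
  rwa [mul_zero, mul_zero, sub_zero, add_zero] at h

lemma tendsto_airyApprox_div_airyWKB :
    Tendsto (fun x => airyApprox x / airyWKB (-1 / 4) x) atTop (nhds 1) := by
  have h1 := tendsto_rpow_neg_atTop (show (0 : ℝ) < 3 / 2 by norm_num)
  have h2 := tendsto_rpow_neg_atTop (show (0 : ℝ) < 3 by norm_num)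
  have h := ((h1.const_mul (5 / 48)).const_sub 1).add (h2.const_mul (35 / 192))
  simp only [mul_zero, sub_zero, add_zero] at h
  refine h.congr' ?_
  filter_upwards [eventually_gt_atTop 0] with x hx
  have h0 := airyWKB_pos (-1 / 4) hx
  rw [airyApprox, airyWKB_eq_rpow_mul (-7 / 4) (-1 / 4) hx,
    airyWKB_eq_rpow_mul (-13 / 4) (-1 / 4) hx, eq_div_iff h0.ne',
    show (-7 / 4 - -1 / 4 : ℝ) = -(3 / 2) by norm_num,
    show (-13 / 4 - -1 / 4 : ℝ) = -3 by norm_num]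
  ring

section AirySolution

variable {u y : ℝ → ℝ}

/-- A solution of the Airy equation tending to zero has a nonpositive product with its derivative on `[0, ∞)`. -/
lemma airy_mul_deriv_nonpos (hu : ∀ x, HasDerivAt u (y x) x)
    (hy : ∀ x, HasDerivAt y (x * u x) x) (hlim : Tendsto u atTop (nhds 0)) {x : ℝ} (hx : 0 ≤ x) :
    u x * y x ≤ 0 := by
  by_contra! hpos
  have hmono : MonotoneOn (fun t => u t * y t) (Set.Ici 0) := by
    refine monotoneOn_of_hasDerivWithinAt_nonneg (convex_Ici 0)
      (fun t _ => ((hu t).mul (hy t)).continuousAt.continuousWithinAt)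
      (fun t _ => ((hu t).mul (hy t)).hasDerivWithinAt) fun t ht => ?_
    rw [interior_Ici] at ht
    have ht' : (0 : ℝ) ≤ t := le_of_lt ht
    have : 0 ≤ y t * y t + t * (u t * u t) :=
      add_nonneg (mul_self_nonneg _) (mul_nonneg ht' (mul_self_nonneg _))
    linarith
  have hsq : MonotoneOn (fun t => u t * u t) (Set.Ici x) := by
    refine monotoneOn_of_hasDerivWithinAt_nonneg (convex_Ici x)
      (fun t _ => ((hu t).mul (hu t)).continuousAt.continuousWithinAt)
      (fun t _ => ((hu t).mul (hu t)).hasDerivWithinAt) fun t ht => ?_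
    rw [interior_Ici] at ht
    have ht' : x < t := ht
    have : u x * y x ≤ u t * y t := hmono hx (hx.trans ht'.le) ht'.le
    linarith
  have h0 : u x * u x ≤ 0 := by
    refine ge_of_tendsto (by simpa using hlim.mul hlim) ?_
    filter_upwards [eventually_ge_atTop x] with t ht
    exact hsq (Set.mem_Ici.2 le_rfl) ht ht
  have : u x = 0 := mul_self_eq_zero.1 (le_antisymm h0 (mul_self_nonneg _))
  simp [this] at hpos

lemma airy_pos (hu : ∀ x, HasDerivAt u (y x) x)
    (hy : ∀ x, HasDerivAt y (x * u x) x) (hlim : Tendsto u atTop (nhds 0))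
    (hev : ∀ᶠ x in atTop, 0 < u x) {x : ℝ} (hx : 0 ≤ x) : 0 < u x := by
  obtain ⟨X, hX, hxX⟩ := (hev.and (eventually_ge_atTop x)).exists
  have hsq : AntitoneOn (fun t => u t * u t) (Set.Ici 0) := by
    refine antitoneOn_of_hasDerivWithinAt_nonpos (convex_Ici 0)
      (fun t _ => ((hu t).mul (hu t)).continuousAt.continuousWithinAt)
      (fun t _ => ((hu t).mul (hu t)).hasDerivWithinAt) fun t ht => ?_
    rw [interior_Ici] at ht
    have := airy_mul_deriv_nonpos hu hy hlim (le_of_lt (Set.mem_Ioi.1 ht))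
    linarith
  by_contra! hneg
  have hcont : ContinuousOn u (Set.Icc x X) := fun t _ => (hu t).continuousAt.continuousWithinAt
  obtain ⟨z, hz, hz0⟩ := intermediate_value_Icc hxX hcont ⟨hneg, hX.le⟩
  have hle : u X * u X ≤ u z * u z := hsq (hx.trans hz.1) (hx.trans hxX) hz.2
  rw [hz0] at hle
  nlinarith

lemma airy_deriv_nonpos (hu : ∀ x, HasDerivAt u (y x) x)
    (hy : ∀ x, HasDerivAt y (x * u x) x) (hlim : Tendsto u atTop (nhds 0))
    (hev : ∀ᶠ x in atTop, 0 < u x) {x : ℝ} (hx : 0 ≤ x) : y x ≤ 0 :=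
  nonpos_of_mul_nonpos_right (airy_mul_deriv_nonpos hu hy hlim hx) (airy_pos hu hy hlim hev hx)

lemma airy_deriv_tendsto_zero (hu : ∀ x, HasDerivAt u (y x) x)
    (hy : ∀ x, HasDerivAt y (x * u x) x) (hlim : Tendsto u atTop (nhds 0))
    (hev : ∀ᶠ x in atTop, 0 < u x) : Tendsto y atTop (nhds 0) := by
  have hmono : MonotoneOn y (Set.Ici 0) := by
    refine monotoneOn_of_hasDerivWithinAt_nonneg (convex_Ici 0)
      (fun t _ => (hy t).continuousAt.continuousWithinAt)
      (fun t _ => (hy t).hasDerivWithinAt) fun t ht => ?_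
    rw [interior_Ici] at ht
    have ht' : (0 : ℝ) < t := ht
    exact mul_nonneg ht'.le (airy_pos hu hy hlim hev ht'.le).le
  have hshift : Tendsto (fun x => -u (x - 1)) atTop (nhds 0) := by
    simpa [← sub_eq_add_neg] using (hlim.comp (tendsto_atTop_add_const_right _ (-1 : ℝ) tendsto_id)).neg
  refine tendsto_of_tendsto_of_tendsto_of_le_of_le' hshift tendsto_const_nhds ?_ ?_
  · filter_upwards [eventually_ge_atTop 1] with x hx
    obtain ⟨z, hz, hz'⟩ := exists_hasDerivAt_eq_slope u y (show x - 1 < x by linarith)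
      (fun t _ => (hu t).continuousAt.continuousWithinAt) (fun t _ => hu t)
    have h1 : y z ≤ y x := hmono (show (0 : ℝ) ≤ z by linarith [hz.1])
      (show (0 : ℝ) ≤ x by linarith) hz.2.le
    have h2 := airy_pos hu hy hlim hev (show 0 ≤ x by linarith)
    rw [sub_sub_cancel, div_one] at hz'
    linarith
  · filter_upwards [eventually_ge_atTop 0] with x hx
    exact airy_deriv_nonpos hu hy hlim hev hx

/-- The Wronskian of the derivative of `u` and its two-term approximation has a sign. -/
lemma airy_wronskian_nonneg (hu : ∀ x, HasDerivAt u (y x) x)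
    (hy : ∀ x, HasDerivAt y (x * u x) x) (hlim : Tendsto u atTop (nhds 0))
    (hev : ∀ᶠ x in atTop, 0 < u x) {x : ℝ} (hx : 0 < x) :
    0 ≤ -(y x * airyApprox x) - u x * airyDerivApprox x := by
  have hderiv : ∀ t : ℝ, 0 < t →
      HasDerivAt (fun t => -(y t * airyApprox t) - u t * airyDerivApprox t)
        (455 / 768 * (y t * airyWKB (-17 / 4) t)) t := fun t ht =>
    (((hy t).mul (hasDerivAt_airyApprox ht)).neg.sub
      ((hu t).mul (hasDerivAt_airyDerivApprox ht))).congr_deriv (by ring)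
  have hanti : AntitoneOn (fun t => -(y t * airyApprox t) - u t * airyDerivApprox t)
      (Set.Ioi 0) := by
    refine antitoneOn_of_hasDerivWithinAt_nonpos (convex_Ioi 0)
      (fun t ht => (hderiv t ht).continuousAt.continuousWithinAt)
      (fun t ht => (hderiv t (interior_subset ht)).hasDerivWithinAt) fun t ht => ?_
    have ht' : (0 : ℝ) < t := interior_subset ht
    have := mul_nonpos_of_nonpos_of_nonneg (airy_deriv_nonpos hu hy hlim hev ht'.le)
      (airyWKB_pos (-17 / 4) ht').le
    linarith
  have htend : Tendsto (fun t => -(y t * airyApprox t) - u t * airyDerivApprox t) atTop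
      (nhds 0) := by
    simpa using ((airy_deriv_tendsto_zero hu hy hlim hev).mul tendsto_airyApprox_atTop).neg.sub
      (hlim.mul tendsto_airyDerivApprox_atTop)
  refine le_of_tendsto htend ?_
  filter_upwards [eventually_ge_atTop x] with t ht
  exact hanti hx (hx.trans_le ht) ht

/-- A solution of the Airy equation asymptotic to `c * x ^ (-1/4) * exp (-(2/3) x ^ (3/2))` has
derivative bounded by the two-term expansion. -/
lemma abs_airy_deriv_le {c : ℝ} (hc : 0 < c) (hu : ∀ x, HasDerivAt u (y x) x)
    (hy : ∀ x, HasDerivAt y (x * u x) x)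
    (hasymp : Tendsto (fun x => u x / airyWKB (-1 / 4) x) atTop (nhds c)) {x : ℝ} (hx : 0 < x) :
    |y x| ≤ c * airyDerivApprox x := by
  have hlim : Tendsto u atTop (nhds 0) := by
    have h := hasymp.mul (tendsto_airyWKB_atTop (-1 / 4))
    rw [mul_zero] at h
    refine h.congr' ?_
    filter_upwards [eventually_gt_atTop 0] with t ht
    exact div_mul_cancel₀ _ (airyWKB_pos _ ht).ne'
  have hev : ∀ᶠ t in atTop, 0 < u t := by
    filter_upwards [hasymp.eventually_const_lt hc, eventually_gt_atTop 0] with t h ht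
    exact (div_pos_iff_of_pos_right (airyWKB_pos _ ht)).1 h
  have hderiv : ∀ t : ℝ, 0 < t → HasDerivAt (fun t => y t / airyDerivApprox t)
      (-(t * (-(y t * airyApprox t) - u t * airyDerivApprox t)) / airyDerivApprox t ^ 2) t :=
    fun t ht => ((hy t).div (hasDerivAt_airyDerivApprox ht)
      (airyDerivApprox_pos ht).ne').congr_deriv (by ring)
  have hanti : AntitoneOn (fun t => y t / airyDerivApprox t) (Set.Ioi 0) := by
    refine antitoneOn_of_hasDerivWithinAt_nonpos (convex_Ioi 0)
      (fun t ht => (hderiv t ht).continuousAt.continuousWithinAt)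
      (fun t ht => (hderiv t (interior_subset ht)).hasDerivWithinAt) fun t ht => ?_
    have ht' : (0 : ℝ) < t := interior_subset ht
    exact div_nonpos_of_nonpos_of_nonneg (neg_nonpos.2
      (mul_nonneg ht'.le (airy_wronskian_nonneg hu hy hlim hev ht'))) (sq_nonneg _)
  have hratio : Tendsto (fun t => u t / airyApprox t) atTop (nhds c) := by
    have h := hasymp.div tendsto_airyApprox_div_airyWKB one_ne_zero
    rw [div_one] at h
    refine h.congr' ?_
    filter_upwards [eventually_gt_atTop 0] with t ht
    exact div_div_div_cancel_right₀ (airyWKB_pos _ ht).ne' _ _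
  have happrox : ∀ᶠ t in atTop, 0 < airyApprox t := by
    filter_upwards [tendsto_airyApprox_div_airyWKB.eventually_const_lt one_pos,
      eventually_gt_atTop 0] with t h ht
    exact (div_pos_iff_of_pos_right (airyWKB_pos _ ht)).1 h
  have htend : Tendsto (fun t => y t / airyDerivApprox t) atTop (nhds (-c)) := by
    refine HasDerivAt.lhopital_zero_atTop (f' := fun t => t * u t)
      (g' := fun t => -(t * airyApprox t)) (Eventually.of_forall hy) ?_ ?_
      (airy_deriv_tendsto_zero hu hy hlim hev) tendsto_airyDerivApprox_atTop ?_
    · filter_upwards [eventually_gt_atTop 0] with t ht using hasDerivAt_airyDerivApprox ht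
    · filter_upwards [eventually_gt_atTop 0, happrox] with t ht h
      exact neg_ne_zero.2 (mul_pos ht h).ne'
    · refine hratio.neg.congr' ?_
      filter_upwards [eventually_gt_atTop 0] with t ht
      rw [div_neg, mul_div_mul_left _ _ ht.ne']
  have hle : -c ≤ y x / airyDerivApprox x := by
    refine le_of_tendsto htend ?_
    filter_upwards [eventually_ge_atTop x] with t ht
    exact hanti hx (hx.trans_le ht) ht
  rw [le_div_iff₀ (airyDerivApprox_pos hx)] at hle
  rw [abs_of_nonpos (airy_deriv_nonpos hu hy hlim hev hx.le)]
  linarith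

end AirySolution

lemma airyDerivApprox_eq {x : ℝ} (hx : 0 < x) :
    airyDerivApprox x = x ^ ((1 : ℝ) / 4) * Real.exp (-(2 / 3) * x ^ ((3 : ℝ) / 2)) *
      (1 + 7 / (48 * x ^ ((3 : ℝ) / 2))) := by
  have h : x ^ ((3 : ℝ) / 2) ≠ 0 := (Real.rpow_pos_of_pos hx _).ne'
  rw [airyDerivApprox, airyWKB_eq_rpow_mul (-5 / 4) (1 / 4) hx,
    show (-5 / 4 - 1 / 4 : ℝ) = -(3 / 2) by norm_num, Real.rpow_neg hx.le, airyWKB]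
  field_simp

lemma exp_mul_sq_mul_airyDerivApprox_le {x : ℝ} (hx : 1 / 2 ≤ x) :
    Real.exp x * (2 * x) ^ 2 * airyDerivApprox x ≤ 96 * Real.exp (8 / 3) := by
  have hx0 : 0 < x := by linarith
  obtain ⟨t, ht, rfl⟩ : ∃ t : ℝ, 0 < t ∧ t ^ 2 = x := ⟨√x, Real.sqrt_pos.2 hx0, Real.sq_sqrt hx0.le⟩
  have h32 : (t ^ 2) ^ ((3 : ℝ) / 2) = t ^ 3 := by
    rw [← Real.rpow_natCast t 2, ← Real.rpow_mul ht.le, ← Real.rpow_natCast t 3]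
    norm_num
  have h14 : (t ^ 2) ^ ((1 : ℝ) / 4) ≤ 2 * t ^ 2 := by
    calc (t ^ 2) ^ ((1 : ℝ) / 4) ≤ (2 * t ^ 2) ^ ((1 : ℝ) / 4) := by gcongr; linarith
      _ ≤ (2 * t ^ 2) ^ (1 : ℝ) := Real.rpow_le_rpow_of_exponent_le (by linarith) (by norm_num)
      _ = 2 * t ^ 2 := Real.rpow_one _
  have ht2 : 1 / 2 ≤ t := by nlinarith
  have ht3 : 1 / 4 ≤ t ^ 3 := by nlinarith
  have h7 : 1 + 7 / (48 * t ^ 3) ≤ 2 := by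
    have : 7 / (48 * t ^ 3) ≤ 1 := (div_le_one (by positivity)).2 (by linarith)
    linarith
  have hexp : Real.exp (t ^ 2) * Real.exp (-(2 / 3) * t ^ 3) ≤
      Real.exp (8 / 3) * Real.exp (-t ^ 2) := by
    rw [← Real.exp_add, ← Real.exp_add, Real.exp_le_exp]
    nlinarith [mul_nonneg (sq_nonneg (t - 2)) (show 0 ≤ t + 1 by linarith)]
  have hpow : Real.exp (-t ^ 2) * (t ^ 2) ^ 3 ≤ 6 := by
    have h := Real.pow_div_factorial_le_exp (t ^ 2) hx0.le 3
    rw [Real.exp_neg, inv_mul_le_iff₀ (Real.exp_pos _)]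
    norm_num [Nat.factorial] at h
    linarith
  rw [airyDerivApprox_eq hx0, h32]
  calc Real.exp (t ^ 2) * (2 * t ^ 2) ^ 2 *
        ((t ^ 2) ^ ((1 : ℝ) / 4) * Real.exp (-(2 / 3) * t ^ 3) * (1 + 7 / (48 * t ^ 3)))
      = Real.exp (t ^ 2) * Real.exp (-(2 / 3) * t ^ 3) * ((2 * t ^ 2) ^ 2 *
        ((t ^ 2) ^ ((1 : ℝ) / 4) * (1 + 7 / (48 * t ^ 3)))) := by ring
    _ ≤ Real.exp (8 / 3) * Real.exp (-t ^ 2) * ((2 * t ^ 2) ^ 2 * (2 * t ^ 2 * 2)) := by gcongr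
    _ = 16 * Real.exp (8 / 3) * (Real.exp (-t ^ 2) * (t ^ 2) ^ 3) := by ring
    _ ≤ 16 * Real.exp (8 / 3) * 6 := by gcongr
    _ = 96 * Real.exp (8 / 3) := by ring

/-- For the Airy function `Ai`, for `x > 0`,
`|Ai'(x)| ≤ (x^{1/4} e^{−(2/3)x^{3/2}}/(2√π))(1 + 7/(48 x^{3/2}))`, and consequently
`sup_{s ≥ 1} e^{s/2} s² |Ai'(s/2)| < ∞`. -/
theorem stmt_14 (Ai : ℝ → ℝ) (hsmooth : ContDiff ℝ 2 Ai)
    (hODE : ∀ x, deriv (deriv Ai) x = x * Ai x)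
    (hasymp : Tendsto
      (fun x => Ai x * (2 * Real.sqrt π * x ^ ((1 : ℝ) / 4)) *
        Real.exp ((2 / 3) * x ^ ((3 : ℝ) / 2)))
      atTop (nhds 1)) :
    (∀ x : ℝ, 0 < x →
      |deriv Ai x| ≤
        x ^ ((1 : ℝ) / 4) * Real.exp (-(2 / 3) * x ^ ((3 : ℝ) / 2)) / (2 * Real.sqrt π) *
          (1 + 7 / (48 * x ^ ((3 : ℝ) / 2)))) ∧
      ∃ C : ℝ, ∀ s : ℝ, 1 ≤ s → Real.exp (s / 2) * s ^ 2 * |deriv Ai (s / 2)| ≤ C := by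
  have hu : ∀ x, HasDerivAt Ai (deriv Ai x) x := fun x =>
    (hsmooth.differentiable (by norm_num) x).hasDerivAt
  have hy : ∀ x, HasDerivAt (deriv Ai) (x * Ai x) x := fun x => by
    rw [← hODE x]
    exact ((hsmooth.differentiable_deriv_two) x).hasDerivAt
  have hπ : 0 < 2 * √π := by positivity
  have hc : 0 < 1 / (2 * √π) := by positivity
  have hlim : Tendsto (fun x => Ai x / airyWKB (-1 / 4) x) atTop (nhds (1 / (2 * √π))) := by
    refine (hasymp.div_const (2 * √π)).congr' ?_
    filter_upwards [eventually_gt_atTop 0] with x hx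
    rw [airyWKB, neg_div, Real.rpow_neg hx.le, neg_mul, Real.exp_neg]
    field_simp
  have hbound : ∀ x : ℝ, 0 < x → |deriv Ai x| ≤ 1 / (2 * √π) * airyDerivApprox x :=
    fun x hx => abs_airy_deriv_le hc hu hy hlim hx
  refine ⟨fun x hx => (hbound x hx).trans_eq ?_,
    1 / (2 * √π) * (96 * Real.exp (8 / 3)), fun s hs => ?_⟩
  · rw [airyDerivApprox_eq hx]
    ring
  · have h := exp_mul_sq_mul_airyDerivApprox_le (x := s / 2) (by linarith)
    rw [mul_div_cancel₀ s two_ne_zero] at h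
    calc Real.exp (s / 2) * s ^ 2 * |deriv Ai (s / 2)|
        ≤ Real.exp (s / 2) * s ^ 2 * (1 / (2 * √π) * airyDerivApprox (s / 2)) := by
          gcongr
          exact hbound _ (by linarith)
      _ = 1 / (2 * √π) * (Real.exp (s / 2) * s ^ 2 * airyDerivApprox (s / 2)) := by ring
      _ ≤ 1 / (2 * √π) * (96 * Real.exp (8 / 3)) := by gcongr
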